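/- Let q be a prime power, F the finite field with q elements, n ≥ 1 an integer, and μ ∈ [1,n] a real. Let (A_i)_{i≥1} be an infinite sequence of linear codes over F with strictly increasing lengths N_i, where each A_i is a Cartesian product A_i = C_{i,1} × ⋯ × C_{i,ℓ_i} of linear codes, each constituent C_{i,j} being a linear [n_{i,j}, n_{i,j}-1] code over F of length n_{i,j} ≤ n, and suppose the average constituent length satisfies limsup_{i→∞} N_i/ℓ_i ≤ μ. Then for any sequence (ω_i)_{i≥1} of nonnegative reals with liminf_i ω_i = ω, one has limsup_{i→∞} (1/N_i)·log_q( |A_i| / |A_i(ω_i)| ) ≤ R̄_0(ω,n,μ). -/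

import Mathlib

open Filter Set

noncomputable section

/-- `λ_q(ω,n)`. -/
def lambdaQ (q : ℕ) (ω : ℝ) (n : ℕ) : ℝ :=
  ⨅ z : Set.Ioc (0:ℝ) 1,
    (-ω * Real.logb q (z : ℝ) - 1 / n +
      (1 / n) * Real.logb q ((1 + ((q:ℝ) - 1) * (z:ℝ)) ^ n + ((q:ℝ) - 1) * (1 - (z:ℝ)) ^ n))

/-- `R_0(ω,n) = (n-1)/n - λ_q(ω,n)`. -/
def R0 (q : ℕ) (ω : ℝ) (n : ℕ) : ℝ := ((n:ℝ) - 1) / n - lambdaQ q ω n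

/-- The inner minimum `min_ϑ Σ_{s∈[n]} π_s·R_0(ϑ_s,s)` over nonnegative vectors `ϑ`
with `Σ_s π_s·ϑ_s = ω`. -/
def innerMin (q n : ℕ) (ω : ℝ) (π : ℕ → ℝ) : ℝ :=
  sInf {t : ℝ | ∃ ϑ : ℕ → ℝ, (∀ s ∈ Finset.Icc 1 n, 0 ≤ ϑ s) ∧
    (∑ s ∈ Finset.Icc 1 n, π s * ϑ s) = ω ∧
    t = ∑ s ∈ Finset.Icc 1 n, π s * R0 q (ϑ s) s}

/-- `R̄_0(ω,n,μ) = max_π min_ϑ Σ_{s∈[n]} π_s·R_0(ϑ_s,s)`, the maximum over nonnegative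
`π` with `Σ_s π_s = 1` and `Σ_s π_s/s ≥ 1/μ`. -/
def Rbar0 (q n : ℕ) (ω μ : ℝ) : ℝ :=
  sSup {r : ℝ | ∃ π : ℕ → ℝ, (∀ s ∈ Finset.Icc 1 n, 0 ≤ π s) ∧
    (∑ s ∈ Finset.Icc 1 n, π s) = 1 ∧
    1 / μ ≤ (∑ s ∈ Finset.Icc 1 n, π s / (s : ℝ)) ∧
    r = innerMin q n ω π}

open Finset in
/-- Second moment of a sum of centred independent bounded variables on a finite product space. -/
theorem sum_prod_mul_sq_le {ι : Type*} [Fintype ι] [DecidableEq ι] {X : ι → Type*}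
    [∀ i, Fintype (X i)] (p Y : ∀ i, X i → ℝ) (B : ℝ)
    (hp0 : ∀ i x, 0 ≤ p i x) (hp1 : ∀ i, ∑ x, p i x = 1)
    (hY : ∀ i, ∑ x, p i x * Y i x = 0) (hB : ∀ i x, |Y i x| ≤ B) :
    ∑ y : ∀ i, X i, (∏ i, p i (y i)) * (∑ i, Y i (y i)) ^ 2 ≤ Fintype.card ι * B ^ 2 := by
  have cross : ∀ j k, j ≠ k →
      ∑ y : ∀ i, X i, (∏ i, p i (y i)) * (Y j (y j) * Y k (y k)) = 0 := by
    intro j k hjk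
    have h : ∀ y : ∀ i, X i, (∏ i, p i (y i)) * (Y j (y j) * Y k (y k)) =
        ∏ i, (p i (y i) * ((if i = j then Y i (y i) else 1) * if i = k then Y i (y i) else 1)) := by
      intro y
      simp_rw [Finset.prod_mul_distrib, Finset.prod_ite_eq', Finset.mem_univ, if_true]
    simp_rw [h]
    rw [← Fintype.piFinset_univ, ← Finset.prod_univ_sum (fun i => (univ : Finset (X i)))
      (fun i x => p i x * ((if i = j then Y i x else 1) * if i = k then Y i x else 1))]
    refine Finset.prod_eq_zero (mem_univ j) ?_
    simpa [hjk] using hY j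
  have diag : ∀ j, ∑ y : ∀ i, X i, (∏ i, p i (y i)) * (Y j (y j) * Y j (y j)) ≤ B ^ 2 := by
    intro j
    calc ∑ y : ∀ i, X i, (∏ i, p i (y i)) * (Y j (y j) * Y j (y j))
        ≤ ∑ y : ∀ i, X i, (∏ i, p i (y i)) * B ^ 2 := by
          refine Finset.sum_le_sum fun y _ => ?_
          refine mul_le_mul_of_nonneg_left ?_ (Finset.prod_nonneg fun i _ => hp0 i _)
          have := sq_le_sq' (abs_le.1 (hB j (y j))).1 (abs_le.1 (hB j (y j))).2
          nlinarith
      _ = B ^ 2 := by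
          rw [← Finset.sum_mul, ← Fintype.piFinset_univ,
            ← Finset.prod_univ_sum (fun i => (univ : Finset (X i))) p]
          simp [hp1]
  calc ∑ y : ∀ i, X i, (∏ i, p i (y i)) * (∑ i, Y i (y i)) ^ 2
      = ∑ j, ∑ k, ∑ y : ∀ i, X i, (∏ i, p i (y i)) * (Y j (y j) * Y k (y k)) := by
        simp_rw [sq, Finset.sum_mul_sum, Finset.mul_sum]
        rw [Finset.sum_comm]
        exact Finset.sum_congr rfl fun j _ => Finset.sum_comm
    _ = ∑ j, ∑ y : ∀ i, X i, (∏ i, p i (y i)) * (Y j (y j) * Y j (y j)) := by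
        refine Finset.sum_congr rfl fun j _ => ?_
        exact Finset.sum_eq_single j (fun k _ hk => cross j k hk.symm) (by simp)
    _ ≤ ∑ _j : ι, B ^ 2 := Finset.sum_le_sum fun j _ => diag j
    _ = Fintype.card ι * B ^ 2 := by simp

/-- The weight enumerator `∑ z^w` of a finite set carrying a weight function `w`. -/
def weightEnum {X : Type*} [Fintype X] (w : X → ℕ) (z : ℝ) : ℝ := ∑ x, z ^ w x

/-- The mean of `w` under the distribution proportional to `z^w`. -/
def tiltedMean {X : Type*} [Fintype X] (w : X → ℕ) (z : ℝ) : ℝ :=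
  (∑ x, z ^ w x * w x) / weightEnum w z

theorem weightEnum_pos {X : Type*} [Fintype X] [Nonempty X] (w : X → ℕ) {z : ℝ} (hz : 0 < z) :
    0 < weightEnum w z :=
  Finset.sum_pos (fun _ _ => pow_pos hz _) Finset.univ_nonempty

theorem tiltedMean_mem_Icc {X : Type*} [Fintype X] [Nonempty X] (w : X → ℕ) {B : ℕ}
    (hw : ∀ x, w x ≤ B) {z : ℝ} (hz : 0 < z) : tiltedMean w z ∈ Icc (0 : ℝ) B := by
  have hW := weightEnum_pos w hz
  refine ⟨div_nonneg (Finset.sum_nonneg fun x _ => by positivity) hW.le, ?_⟩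
  rw [tiltedMean, div_le_iff₀ hW, weightEnum, Finset.mul_sum]
  refine Finset.sum_le_sum fun x _ => ?_
  rw [mul_comm]
  exact mul_le_mul_of_nonneg_right (by exact_mod_cast hw x) (by positivity)

theorem tiltedMean_le_mul {X : Type*} [Fintype X] (w : X → ℕ) {B : ℕ}
    (hw : ∀ x, w x ≤ B) (h0 : ∃ x, w x = 0) {z : ℝ} (hz : 0 < z) (hz1 : z ≤ 1) :
    tiltedMean w z ≤ Fintype.card X * B * z := by
  obtain ⟨x₀, hx₀⟩ := h0
  have hW : 1 ≤ weightEnum w z := by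
    have := Finset.single_le_sum (f := fun x => z ^ w x) (fun x _ => by positivity)
      (Finset.mem_univ x₀)
    simpa [hx₀, weightEnum] using this
  have hnum : ∑ x, z ^ w x * (w x : ℝ) ≤ Fintype.card X * B * z := by
    calc ∑ x, z ^ w x * (w x : ℝ) ≤ ∑ _x : X, z * B := by
          refine Finset.sum_le_sum fun x _ => ?_
          rcases Nat.eq_zero_or_pos (w x) with h | h
          · rw [h]; simp; positivity
          · have h1 : z ^ w x ≤ z := by
              simpa using pow_le_pow_of_le_one hz.le hz1 h
            have h2 : (w x : ℝ) ≤ B := by exact_mod_cast hw x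
            gcongr
      _ = Fintype.card X * B * z := by simp; ring
  exact (div_le_self (Finset.sum_nonneg fun x _ => by positivity) hW).trans hnum

theorem continuousOn_tiltedMean {X : Type*} [Fintype X] [Nonempty X] (w : X → ℕ) :
    ContinuousOn (tiltedMean w) (Ioi 0) := by
  refine ContinuousOn.div (by fun_prop) ?_ fun z hz => (weightEnum_pos w hz).ne'
  unfold weightEnum
  fun_prop

open Finset in
/-- Chebyshev's inequality for the product of the tilted distributions. -/
theorem half_prod_weightEnum_le {ι : Type*} [Fintype ι] [DecidableEq ι] {X : ι → Type*}
    [∀ i, Fintype (X i)] [∀ i, Nonempty (X i)] (w : ∀ i, X i → ℕ) {B : ℕ}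
    (hw : ∀ i x, w i x ≤ B) {z : ℝ} (hz : 0 < z) {a : ℝ} (ha : 0 < a)
    (hcard : Fintype.card ι * (B : ℝ) ^ 2 ≤ a ^ 2 / 2) :
    (∏ i, weightEnum (w i) z) / 2 ≤
      ∑ y : ∀ i, X i with |(∑ i, w i (y i) : ℕ) - ∑ i, tiltedMean (w i) z| ≤ a,
        z ^ (∑ i, w i (y i)) := by
  have hW : ∀ i, 0 < weightEnum (w i) z := fun i => weightEnum_pos (w i) hz
  have hPW : 0 < ∏ i, weightEnum (w i) z := Finset.prod_pos fun i _ => hW i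
  set p : ∀ i, X i → ℝ := fun i x => z ^ w i x / weightEnum (w i) z with hp
  set Y : ∀ i, X i → ℝ := fun i x => w i x - tiltedMean (w i) z with hYdef
  have hp0 : ∀ i x, 0 ≤ p i x := fun i x => div_nonneg (by positivity) (hW i).le
  have hp1 : ∀ i, ∑ x, p i x = 1 := by
    intro i
    simp only [hp]
    rw [← Finset.sum_div]
    exact div_self (hW i).ne'
  have hY0 : ∀ i, ∑ x, p i x * Y i x = 0 := by
    intro i
    simp only [hYdef, mul_sub, Finset.sum_sub_distrib]
    rw [← Finset.sum_mul, hp1, one_mul, sub_eq_zero, tiltedMean, Finset.sum_div]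
    exact Finset.sum_congr rfl fun x _ => by simp only [hp]; ring
  have hYB : ∀ i x, |Y i x| ≤ B := by
    intro i x
    have h1 := tiltedMean_mem_Icc (w i) (hw i) hz
    have h2 : (w i x : ℝ) ≤ B := by exact_mod_cast hw i x
    have h3 : (0 : ℝ) ≤ w i x := by positivity
    rw [abs_le]
    constructor <;> simp only [hYdef] <;> linarith [h1.1, h1.2]
  have hP0 : ∀ y : ∀ i, X i, 0 ≤ ∏ i, p i (y i) := fun y => Finset.prod_nonneg fun i _ => hp0 i _
  have hvar := sum_prod_mul_sq_le p Y B hp0 hp1 hY0 hYB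
  have htot : ∑ y : ∀ i, X i, ∏ i, p i (y i) = 1 := by
    rw [← Fintype.piFinset_univ, ← Finset.prod_univ_sum (fun i => (univ : Finset (X i))) p]
    simp [hp1]
  have hYsum : ∀ y : ∀ i, X i,
      ((∑ i, w i (y i) : ℕ) : ℝ) - ∑ i, tiltedMean (w i) z = ∑ i, Y i (y i) := by
    intro y; simp [hYdef]
  have hprod : ∀ y : ∀ i, X i,
      z ^ (∑ i, w i (y i)) = (∏ i, weightEnum (w i) z) * ∏ i, p i (y i) := by
    intro y
    rw [← Finset.prod_mul_distrib, ← Finset.prod_pow_eq_pow_sum]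
    exact Finset.prod_congr rfl fun i _ => (mul_div_cancel₀ _ (hW i).ne').symm
  have htail : ∑ y : ∀ i, X i with ¬ |(∑ i, w i (y i) : ℕ) - ∑ i, tiltedMean (w i) z| ≤ a,
      ∏ i, p i (y i) ≤ 1 / 2 := by
    have : a ^ 2 * ∑ y : ∀ i, X i with ¬ |(∑ i, w i (y i) : ℕ) - ∑ i, tiltedMean (w i) z| ≤ a,
        ∏ i, p i (y i) ≤ a ^ 2 * (1 / 2) := by
      calc _ ≤ ∑ y : ∀ i, X i with ¬ |(∑ i, w i (y i) : ℕ) - ∑ i, tiltedMean (w i) z| ≤ a,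
            (∏ i, p i (y i)) * (∑ i, Y i (y i)) ^ 2 := by
            rw [Finset.mul_sum]
            refine Finset.sum_le_sum fun y hy => ?_
            have hy' := (Finset.mem_filter.1 hy).2
            rw [hYsum, not_le] at hy'
            rw [mul_comm]
            refine mul_le_mul_of_nonneg_left ?_ (hP0 y)
            rw [← sq_abs (∑ i, Y i (y i))]
            gcongr
        _ ≤ ∑ y : ∀ i, X i, (∏ i, p i (y i)) * (∑ i, Y i (y i)) ^ 2 :=
            Finset.sum_le_sum_of_subset_of_nonneg (Finset.filter_subset _ _)
              fun y _ _ => mul_nonneg (hP0 y) (sq_nonneg _)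
        _ ≤ a ^ 2 * (1 / 2) := by linarith
    exact le_of_mul_le_mul_left this (by positivity)
  have hsplit := Finset.sum_filter_add_sum_filter_not (univ : Finset (∀ i, X i))
    (fun y => |((∑ i, w i (y i) : ℕ) : ℝ) - ∑ i, tiltedMean (w i) z| ≤ a)
    (fun y => ∏ i, p i (y i))
  simp_rw [hprod]
  rw [← Finset.mul_sum, div_eq_mul_inv]
  refine mul_le_mul_of_nonneg_left ?_ hPW.le
  linarith

/-- `log_q` of `q` times the weight enumerator of the parity code of length `s`. -/
def parityLog (q s : ℕ) (z : ℝ) : ℝ :=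
  Real.logb q ((1 + ((q : ℝ) - 1) * z) ^ s + ((q : ℝ) - 1) * (1 - z) ^ s)

theorem one_le_parityEnum {q : ℕ} (hq : 2 ≤ q) (s : ℕ) {z : ℝ} (hz : z ∈ Ioc (0 : ℝ) 1) :
    1 ≤ (1 + ((q : ℝ) - 1) * z) ^ s + ((q : ℝ) - 1) * (1 - z) ^ s := by
  have hq' : (2 : ℝ) ≤ q := by exact_mod_cast hq
  have h1 : 1 ≤ (1 + ((q : ℝ) - 1) * z) ^ s :=
    one_le_pow₀ (by nlinarith [mul_nonneg (by linarith : (0 : ℝ) ≤ q - 1) hz.1.le])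
  have h2 : 0 ≤ ((q : ℝ) - 1) * (1 - z) ^ s :=
    mul_nonneg (by linarith) (pow_nonneg (by linarith [hz.2]) _)
  linarith

theorem parityLog_nonneg {q : ℕ} (hq : 2 ≤ q) (s : ℕ) {z : ℝ} (hz : z ∈ Ioc (0 : ℝ) 1) :
    0 ≤ parityLog q s z :=
  Real.logb_nonneg (by exact_mod_cast hq) (one_le_parityEnum hq s hz)

theorem parityLog_length_one {q : ℕ} (hq : 2 ≤ q) (z : ℝ) : parityLog q 1 z = 1 := by
  have : (1 + ((q : ℝ) - 1) * z) ^ 1 + ((q : ℝ) - 1) * (1 - z) ^ 1 = q := by ring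
  rw [parityLog, this]
  exact Real.logb_self_eq_one (by exact_mod_cast hq)

theorem parityLog_at_one {q : ℕ} (hq : 2 ≤ q) {s : ℕ} (hs : 1 ≤ s) : parityLog q s 1 = s := by
  have hq' : (1 : ℝ) < q := by exact_mod_cast hq
  have : (1 + ((q : ℝ) - 1) * 1) ^ s + ((q : ℝ) - 1) * (1 - 1) ^ s = (q : ℝ) ^ s := by
    rw [sub_self, zero_pow (by omega)]; ring
  rw [parityLog, this, Real.logb_pow, Real.logb_self_eq_one hq', mul_one]

theorem lambdaQ_bddBelow {q : ℕ} (hq : 2 ≤ q) {ω : ℝ} (hω : 0 ≤ ω) (s : ℕ) (z : Ioc (0 : ℝ) 1) :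
    -(1 / (s : ℝ)) ≤ -ω * Real.logb q (z : ℝ) - 1 / s + (1 / s) * parityLog q s z := by
  have h1 : Real.logb q (z : ℝ) ≤ 0 :=
    Real.logb_nonpos (by exact_mod_cast hq) z.2.1.le z.2.2
  have h2 : 0 ≤ (1 / (s : ℝ)) * parityLog q s z :=
    mul_nonneg (by positivity) (parityLog_nonneg hq s z.2)
  nlinarith [mul_nonneg hω (neg_nonneg.2 h1)]

theorem le_R0 {q : ℕ} (hq : 2 ≤ q) {ω : ℝ} (hω : 0 ≤ ω) {s : ℕ} (hs : 1 ≤ s) {z : ℝ}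
    (hz : z ∈ Ioc (0 : ℝ) 1) :
    ω * Real.logb q z + (1 - parityLog q s z / s) ≤ R0 q ω s := by
  have hs' : (s : ℝ) ≠ 0 := by positivity
  have h : lambdaQ q ω s ≤ -ω * Real.logb q z - 1 / s + (1 / s) * parityLog q s z :=
    ciInf_le ⟨-(1 / (s : ℝ)), by rintro _ ⟨z, rfl⟩; exact lambdaQ_bddBelow hq hω s z⟩
      (⟨z, hz⟩ : Ioc (0 : ℝ) 1)
  have h2 : ((s : ℝ) - 1) / s = 1 - 1 / s := by field_simp
  rw [R0, h2]
  have h3 : parityLog q s z / s = (1 / s) * parityLog q s z := by ring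
  rw [h3]
  linarith

theorem R0_nonneg {q : ℕ} (hq : 2 ≤ q) {ω : ℝ} (hω : 0 ≤ ω) {s : ℕ} (hs : 1 ≤ s) :
    0 ≤ R0 q ω s := by
  have := le_R0 hq hω hs (z := 1) ⟨one_pos, le_rfl⟩
  rw [parityLog_at_one hq hs, div_self (by positivity)] at this
  simpa using this

theorem R0_le_one {q : ℕ} (hq : 2 ≤ q) {ω : ℝ} (hω : 0 ≤ ω) {s : ℕ} (hs : 1 ≤ s) :
    R0 q ω s ≤ 1 := by
  have hs' : (s : ℝ) ≠ 0 := by positivity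
  have h : -(1 / (s : ℝ)) ≤ lambdaQ q ω s :=
    haveI : Nonempty (Ioc (0 : ℝ) 1) := ⟨⟨1, one_pos, le_rfl⟩⟩
    le_ciInf fun z => lambdaQ_bddBelow hq hω s z
  have h2 : ((s : ℝ) - 1) / s = 1 - 1 / s := by field_simp
  rw [R0, h2]
  linarith

theorem innerMin_set_nonneg {q n : ℕ} (hq : 2 ≤ q) {ω : ℝ} {π : ℕ → ℝ}
    (hπ : ∀ s ∈ Finset.Icc 1 n, 0 ≤ π s) :
    ∀ t ∈ {t : ℝ | ∃ ϑ : ℕ → ℝ, (∀ s ∈ Finset.Icc 1 n, 0 ≤ ϑ s) ∧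
      (∑ s ∈ Finset.Icc 1 n, π s * ϑ s) = ω ∧
      t = ∑ s ∈ Finset.Icc 1 n, π s * R0 q (ϑ s) s}, 0 ≤ t := by
  rintro t ⟨ϑ, h0, -, rfl⟩
  exact Finset.sum_nonneg fun s hs =>
    mul_nonneg (hπ s hs) (R0_nonneg hq (h0 s hs) (Finset.mem_Icc.1 hs).1)

theorem innerMin_nonneg {q n : ℕ} (hq : 2 ≤ q) {ω : ℝ} {π : ℕ → ℝ}
    (hπ : ∀ s ∈ Finset.Icc 1 n, 0 ≤ π s) : 0 ≤ innerMin q n ω π :=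
  Real.sInf_nonneg (innerMin_set_nonneg hq hπ)

theorem innerMin_le_one {q n : ℕ} (hq : 2 ≤ q) {ω : ℝ} (hω : 0 ≤ ω) {π : ℕ → ℝ}
    (hπ : ∀ s ∈ Finset.Icc 1 n, 0 ≤ π s) (hπ1 : ∑ s ∈ Finset.Icc 1 n, π s = 1) :
    innerMin q n ω π ≤ 1 := by
  refine (csInf_le ⟨0, innerMin_set_nonneg hq hπ⟩ ⟨fun _ => ω, fun _ _ => hω, ?_, rfl⟩).trans ?_
  · rw [← Finset.sum_mul, hπ1, one_mul]
  · rw [← hπ1]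
    exact Finset.sum_le_sum fun s hs =>
      mul_le_of_le_one_right (hπ s hs) (R0_le_one hq hω (Finset.mem_Icc.1 hs).1)

theorem le_innerMin {q n : ℕ} (hq : 2 ≤ q) {ω : ℝ} (hω : 0 ≤ ω) {π : ℕ → ℝ}
    (hπ : ∀ s ∈ Finset.Icc 1 n, 0 ≤ π s) (hπ1 : ∑ s ∈ Finset.Icc 1 n, π s = 1)
    {z : ℝ} (hz : z ∈ Ioc (0 : ℝ) 1) :
    ω * Real.logb q z + ∑ s ∈ Finset.Icc 1 n, π s * (1 - parityLog q s z / s) ≤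
      innerMin q n ω π := by
  refine le_csInf ⟨_, fun _ => ω, fun _ _ => hω, ?_, rfl⟩ ?_
  · rw [← Finset.sum_mul, hπ1, one_mul]
  · rintro t ⟨ϑ, h0, h1, rfl⟩
    rw [← h1, Finset.sum_mul, ← Finset.sum_add_distrib]
    refine Finset.sum_le_sum fun s hs => ?_
    have := mul_le_mul_of_nonneg_left (le_R0 hq (h0 s hs) (Finset.mem_Icc.1 hs).1 hz) (hπ s hs)
    linarith

theorem Rbar0_nonneg {q n : ℕ} (hq : 2 ≤ q) (ω μ : ℝ) : 0 ≤ Rbar0 q n ω μ := by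
  refine Real.sSup_nonneg ?_
  rintro r ⟨π, h0, -, -, rfl⟩
  exact innerMin_nonneg hq h0

theorem innerMin_le_Rbar0 {q n : ℕ} (hq : 2 ≤ q) {ω μ : ℝ} (hω : 0 ≤ ω) {π : ℕ → ℝ}
    (hπ : ∀ s ∈ Finset.Icc 1 n, 0 ≤ π s) (hπ1 : ∑ s ∈ Finset.Icc 1 n, π s = 1)
    (hμ : 1 / μ ≤ ∑ s ∈ Finset.Icc 1 n, π s / (s : ℝ)) :
    innerMin q n ω π ≤ Rbar0 q n ω μ := by
  refine le_csSup ⟨1, ?_⟩ ⟨π, hπ, hπ1, hμ, rfl⟩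
  rintro r ⟨π', h0, h1, -, rfl⟩
  exact innerMin_le_one hq hω h0 h1

/-- A length profile that nearly meets the constraint `∑ π_s / s ≥ 1 / μ` still bounds `Rbar0`
from below up to a small error, by mixing with the profile concentrated on length one. -/
theorem le_Rbar0_add {q n : ℕ} (hq : 2 ≤ q) (hn : 1 ≤ n) {ω μ : ℝ} (hω : 0 ≤ ω) (hμ : 1 ≤ μ)
    {π : ℕ → ℝ} (hπ : ∀ s ∈ Finset.Icc 1 n, 0 ≤ π s) (hπ1 : ∑ s ∈ Finset.Icc 1 n, π s = 1)
    {t : ℝ} (ht : t ∈ Icc (0 : ℝ) 1)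
    (hπμ : 1 / μ - t * (1 - 1 / μ) ≤ ∑ s ∈ Finset.Icc 1 n, π s / (s : ℝ))
    {z : ℝ} (hz : z ∈ Ioc (0 : ℝ) 1) :
    ω * Real.logb q z + ∑ s ∈ Finset.Icc 1 n, π s * (1 - parityLog q s z / s) ≤
      Rbar0 q n ω μ + t := by
  have h1n : 1 ∈ Finset.Icc 1 n := Finset.mem_Icc.2 ⟨le_rfl, hn⟩
  set ρ : ℕ → ℝ := fun s => (1 - t) * π s + if s = 1 then t else 0 with hρ
  have hρ0 : ∀ s ∈ Finset.Icc 1 n, 0 ≤ ρ s := by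
    intro s hs
    have := mul_nonneg (sub_nonneg.2 ht.2) (hπ s hs)
    simp only [hρ]
    split_ifs <;> linarith [ht.1]
  have key : ∀ g : ℕ → ℝ, ∑ s ∈ Finset.Icc 1 n, ρ s * g s =
      (1 - t) * ∑ s ∈ Finset.Icc 1 n, π s * g s + t * g 1 := by
    intro g
    simp only [hρ, add_mul, Finset.sum_add_distrib, ite_mul, zero_mul, mul_assoc,
      ← Finset.mul_sum, Finset.sum_ite_eq', h1n, if_true]
  have hρ1 : ∑ s ∈ Finset.Icc 1 n, ρ s = 1 := by
    have := key fun _ => 1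
    simp only [mul_one, hπ1] at this
    linarith
  have hρμ : 1 / μ ≤ ∑ s ∈ Finset.Icc 1 n, ρ s / (s : ℝ) := by
    have := key fun s => (s : ℝ)⁻¹
    simp only [← div_eq_mul_inv] at this
    rw [this]
    have h1 : 1 / μ ≤ 1 := by rw [div_le_one (by linarith)]; exact hμ
    have h2 := mul_le_mul_of_nonneg_left hπμ (sub_nonneg.2 ht.2)
    have h3 := mul_nonneg (mul_nonneg ht.1 ht.1) (sub_nonneg.2 h1)
    norm_num at h1 h2 h3 ⊢
    nlinarith
  have hle := (le_innerMin hq hω hρ0 hρ1 hz).trans (innerMin_le_Rbar0 hq hω hρ0 hρ1 hρμ)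
  rw [key fun s => 1 - parityLog q s z / s, parityLog_length_one hq] at hle
  have hS : ∑ s ∈ Finset.Icc 1 n, π s * (1 - parityLog q s z / s) ≤ 1 := by
    rw [← hπ1]
    refine Finset.sum_le_sum fun s hs => mul_le_of_le_one_right (hπ s hs) ?_
    have := div_nonneg (parityLog_nonneg hq s hz) (Nat.cast_nonneg (α := ℝ) s)
    linarith
  have := mul_le_mul_of_nonneg_left hS ht.1
  norm_num at hle
  linarith

section Hyperplane

theorem pow_hammingNorm_cons {K : Type*} [Field K] [DecidableEq K] (z : ℝ) {m : ℕ} (c : K)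
    (y : Fin m → K) :
    z ^ hammingNorm (Fin.cons c y : Fin (m + 1) → K) =
      (if c = 0 then 1 else z) * z ^ hammingNorm y := by
  have h : ∀ {k : ℕ} (x : Fin k → K), z ^ hammingNorm x = ∏ i, if x i = 0 then 1 else z := by
    intro k x
    rw [hammingNorm, ← Finset.prod_const, Finset.prod_filter]
    exact Finset.prod_congr rfl fun i _ => by by_cases hx : x i = 0 <;> simp [hx]
  simp [h, Fin.prod_univ_succ]

theorem sum_fin_succ {K : Type*} [Fintype K] {m : ℕ} (F : (Fin (m + 1) → K) → ℝ) :
    ∑ x, F x = ∑ y : Fin m → K, ∑ c : K, F (Fin.cons c y) := by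
  rw [← (Fin.consEquiv fun _ : Fin (m + 1) => K).sum_comp, Fintype.sum_prod_type,
    Finset.sum_comm]
  rfl

variable {K : Type*} [Field K] [Fintype K] [DecidableEq K]

theorem sum_ite_eq_zero_one (z : ℝ) :
    ∑ c : K, (if c = 0 then 1 else z) = 1 + ((Fintype.card K : ℝ) - 1) * z := by
  have h : ∀ c : K, (if c = 0 then 1 else z) = z + if c = 0 then 1 - z else 0 := by
    intro c; split_ifs <;> ring
  simp_rw [h, Finset.sum_add_distrib]
  simp
  ring

theorem sum_pow_hammingNorm (z : ℝ) (m : ℕ) :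
    ∑ x : Fin m → K, z ^ hammingNorm x = (1 + ((Fintype.card K : ℝ) - 1) * z) ^ m := by
  induction m with
  | zero => simp [hammingNorm]
  | succ m ih =>
    simp_rw [sum_fin_succ, pow_hammingNorm_cons, ← Finset.sum_mul, sum_ite_eq_zero_one,
      ← Finset.mul_sum, ih]
    ring

/-- Among the codes defined by one linear equation, the parity code has the smallest weight
enumerator. -/
theorem parityEnum_le_sum {z : ℝ} (hz : z ∈ Ioc (0 : ℝ) 1) {m : ℕ} (a : Fin m → K) :
    ((1 + ((Fintype.card K : ℝ) - 1) * z) ^ m + ((Fintype.card K : ℝ) - 1) * (1 - z) ^ m) ≤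
      Fintype.card K * ∑ x : Fin m → K, if ∑ i, a i * x i = 0 then z ^ hammingNorm x else 0 := by
  have hq : (1 : ℝ) ≤ Fintype.card K := by exact_mod_cast Fintype.card_pos
  induction m with
  | zero => simp [hammingNorm]
  | succ m ih =>
    specialize ih (fun i => a i.succ)
    set T : ℝ := 1 + ((Fintype.card K : ℝ) - 1) * z with hT
    set W := ∑ x : Fin m → K, if ∑ i, a i.succ * x i = 0 then z ^ hammingNorm x else 0
    have hz1 : 0 ≤ 1 - z := sub_nonneg.2 hz.2
    have hTz : 1 - z ≤ T := by nlinarith [hz.1]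
    have hD : 0 ≤ ((Fintype.card K : ℝ) - 1) * (1 - z) ^ m :=
      mul_nonneg (by linarith) (pow_nonneg hz1 _)
    rw [sum_fin_succ]
    simp_rw [pow_hammingNorm_cons, Fin.sum_univ_succ, Fin.cons_zero, Fin.cons_succ]
    by_cases ha : a 0 = 0
    · have h : ∀ y : Fin m → K, (∑ c : K, if a 0 * c + ∑ i, a i.succ * y i = 0 then
          (if c = 0 then 1 else z) * z ^ hammingNorm y else 0) =
          T * if ∑ i, a i.succ * y i = 0 then z ^ hammingNorm y else 0 := by
        intro y
        by_cases hy : ∑ i, a i.succ * y i = 0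
        · simp only [ha, hy, zero_mul, add_zero, if_true]
          rw [← Finset.sum_mul, sum_ite_eq_zero_one]
        · simp [ha, hy]
      simp_rw [h, ← Finset.mul_sum]
      have h1 := mul_le_mul_of_nonneg_left ih (hz1.trans hTz)
      have h2 := mul_le_mul_of_nonneg_right hTz hD
      rw [pow_succ, pow_succ]
      linarith
    · have h : ∀ y : Fin m → K, (∑ c : K, if a 0 * c + ∑ i, a i.succ * y i = 0 then
          (if c = 0 then 1 else z) * z ^ hammingNorm y else 0) =
          z * z ^ hammingNorm y +
            (1 - z) * if ∑ i, a i.succ * y i = 0 then z ^ hammingNorm y else 0 := by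
        intro y
        have hc : ∀ c : K, a 0 * c + ∑ i, a i.succ * y i = 0 ↔
            c = -(∑ i, a i.succ * y i) / a 0 := by
          intro c
          rw [eq_div_iff ha, eq_neg_iff_add_eq_zero, mul_comm]
        simp_rw [hc, Finset.sum_ite_eq', Finset.mem_univ, if_true]
        by_cases hy : ∑ i, a i.succ * y i = 0
        · simp [hy]; ring
        · simp [hy, ha]
      simp_rw [h, Finset.sum_add_distrib, ← Finset.mul_sum, sum_pow_hammingNorm]
      have h1 := mul_le_mul_of_nonneg_left ih hz1
      rw [pow_succ, pow_succ]
      rw [← hT]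
      have h3 : T ^ m * T = Fintype.card K * (z * T ^ m) + (1 - z) * T ^ m := by
        rw [hT]; ring
      linarith

theorem parityLog_le_logb_weightEnum {m : ℕ} (hm : 1 ≤ m) (C : Submodule K (Fin m → K))
    [Fintype C] (hC : Module.finrank K C = m - 1) {z : ℝ} (hz : z ∈ Ioc (0 : ℝ) 1) :
    parityLog (Fintype.card K) m z ≤
      1 + Real.logb (Fintype.card K) (weightEnum (fun x : C => hammingNorm x.1) z) := by
  have hq : 2 ≤ Fintype.card K := Fintype.one_lt_card
  have hq' : (1 : ℝ) < Fintype.card K := by exact_mod_cast hq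
  have hlt : C < ⊤ := by
    refine lt_top_iff_ne_top.2 fun h => ?_
    rw [h, finrank_top, Module.finrank_fin_fun] at hC
    omega
  obtain ⟨f, hf, hle⟩ := Submodule.exists_le_ker_of_lt_top C hlt
  have hker : C = LinearMap.ker f := by
    refine Submodule.eq_of_le_of_finrank_eq hle ?_
    have := Module.Dual.finrank_ker_add_one_of_ne_zero (f := f) hf
    rw [Module.finrank_fin_fun] at this
    omega
  have hmem : ∀ x, x ∈ C ↔ ∑ i, f (Pi.single i 1) * x i = 0 := by
    intro x
    rw [hker, LinearMap.mem_ker, LinearMap.pi_apply_eq_sum_univ f x]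
    simp_rw [smul_eq_mul, mul_comm (x _)]
    refine Eq.congr (Finset.sum_congr rfl fun i _ => ?_) rfl
    congr 2
    ext j
    simp [Pi.single_apply, eq_comm]
  have hsum : weightEnum (fun x : C => hammingNorm x.1) z =
      ∑ x : Fin m → K, if ∑ i, f (Pi.single i 1) * x i = 0 then z ^ hammingNorm x else 0 := by
    rw [weightEnum, ← Finset.sum_filter]
    exact (Finset.sum_subtype _ (fun x => by simp [hmem]) fun x => z ^ hammingNorm x).symm
  have hle' := parityEnum_le_sum hz fun i => f (Pi.single i 1)
  rw [← hsum] at hle'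
  have h1 : (1 : ℝ) = Real.logb (Fintype.card K) (Fintype.card K) :=
    (Real.logb_self_eq_one hq').symm
  rw [h1, ← Real.logb_mul (by positivity) (weightEnum_pos _ hz.1).ne']
  exact Real.logb_le_logb_of_le hq' (one_pos.trans_le (one_le_parityEnum hq m hz)) hle'

end Hyperplane

section ProductCode

theorem hammingNorm_sigma {K : Type*} [Field K] [DecidableEq K] {ℓ : ℕ}
    {m : Fin ℓ → ℕ} (x : (Σ j, Fin (m j)) → K) :
    hammingNorm x = ∑ j, hammingNorm fun t => x ⟨j, t⟩ := by
  simp_rw [hammingNorm, Finset.card_filter, Fintype.sum_sigma]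

variable {K : Type*} [Field K] [DecidableEq K] {ℓ : ℕ} {m : Fin ℓ → ℕ}
  (C : ∀ j, Submodule K (Fin (m j) → K))

/-- The Cartesian product of the codes `C j`. -/
def prodCode : Set ((Σ j, Fin (m j)) → K) := {x | ∀ j, (fun t => x ⟨j, t⟩) ∈ C j}

theorem ncard_prodCode_sep [∀ j, Fintype (C j)] (P : ℕ → Prop) [DecidablePred P] :
    {c ∈ prodCode C | P (hammingNorm c)}.ncard =
      (Finset.univ.filter fun y : ∀ j, C j => P (∑ j, hammingNorm (y j).1)).card := by
  let Ψ : (∀ j, C j) → ((Σ j, Fin (m j)) → K) := fun y p => (y p.1).1 p.2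
  have hΨ : Function.Injective Ψ := by
    intro y y' h
    funext j
    ext t
    exact congrFun h ⟨j, t⟩
  have himg : {c ∈ prodCode C | P (hammingNorm c)} =
      Ψ '' ↑(Finset.univ.filter fun y : ∀ j, C j => P (∑ j, hammingNorm (y j).1)) := by
    ext c
    simp only [Set.mem_ofPred_eq, Set.mem_image, Finset.coe_filter, Finset.mem_univ, true_and]
    constructor
    · rintro ⟨hc, hP⟩
      refine ⟨fun j => ⟨_, hc j⟩, ?_, rfl⟩
      rwa [hammingNorm_sigma] at hP
    · rintro ⟨y, hP, rfl⟩
      refine ⟨fun j => (y j).2, ?_⟩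
      rwa [hammingNorm_sigma]
  rw [himg, Set.ncard_image_of_injective _ hΨ, Set.ncard_coe_finset]

variable [Fintype K]

theorem logb_ncard_prodCode (hm : ∀ j, 1 ≤ m j)
    (hC : ∀ j, Module.finrank K (C j) = m j - 1) :
    Real.logb (Fintype.card K) (prodCode C).ncard = ∑ j, ((m j : ℝ) - 1) := by
  classical
  have hq' : (1 : ℝ) < Fintype.card K := by exact_mod_cast Fintype.one_lt_card
  have : ∀ j, Fintype (C j) := fun j => Fintype.ofFinite _
  have h := ncard_prodCode_sep C fun _ => True
  simp only [and_true, Finset.filter_true] at h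
  have h' : (prodCode C).ncard = ∏ j, Fintype.card K ^ (m j - 1) := by
    rw [show prodCode C = {c | c ∈ prodCode C} from rfl, h, Finset.card_univ, Fintype.card_pi]
    exact Finset.prod_congr rfl fun j _ => by rw [Module.card_eq_pow_finrank (K := K), hC]
  rw [h', Finset.prod_pow_eq_pow_sum]
  push_cast
  rw [Real.logb_pow, Real.logb_self_eq_one hq', mul_one]
  push_cast
  exact Finset.sum_congr rfl fun j _ => by rw [Nat.cast_sub (hm j), Nat.cast_one]

theorem one_le_ncard_prodCode_ball {r : ℝ} (hr : 0 ≤ r) :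
    1 ≤ {c ∈ prodCode C | (hammingNorm c : ℝ) ≤ r}.ncard := by
  rw [Nat.succ_le_iff, Set.ncard_pos]
  refine ⟨0, fun j => ?_, by simpa using hr⟩
  exact (C j).zero_mem

theorem logb_ncard_div_le (hm : ∀ j, 1 ≤ m j)
    (hC : ∀ j, Module.finrank K (C j) = m j - 1) {r : ℝ} (hr : 0 ≤ r) :
    Real.logb (Fintype.card K) ((prodCode C).ncard /
      {c ∈ prodCode C | (hammingNorm c : ℝ) ≤ r}.ncard) ≤ ∑ j, ((m j : ℝ) - 1) := by
  have hq' : (1 : ℝ) < Fintype.card K := by exact_mod_cast Fintype.one_lt_card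
  have h1 : (1 : ℝ) ≤ {c ∈ prodCode C | (hammingNorm c : ℝ) ≤ r}.ncard := by
    exact_mod_cast one_le_ncard_prodCode_ball C hr
  have h2 : 1 ≤ (prodCode C).ncard :=
    (one_le_ncard_prodCode_ball C hr).trans (Set.ncard_le_ncard fun c hc => hc.1)
  have h3 : ((prodCode C).ncard : ℝ) ≠ 0 := by positivity
  rw [Real.logb_div h3 (by positivity), logb_ncard_prodCode C hm hC]
  linarith [Real.logb_nonneg hq' h1]

/-- Lower bound on the number of words of small weight in a product code, in the form of an
upper bound on the logarithm of the index of the ball. -/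
theorem logb_ncard_div_le_of_tilt [∀ j, Fintype (C j)] (hm : ∀ j, 1 ≤ m j)
    (hC : ∀ j, Module.finrank K (C j) = m j - 1) {n : ℕ} (hmn : ∀ j, m j ≤ n)
    {z : ℝ} (hz : z ∈ Ioc (0 : ℝ) 1) {a b r : ℝ} (ha : 0 < a)
    (hcard : (ℓ : ℝ) * (n : ℝ) ^ 2 ≤ a ^ 2 / 2)
    (hr : ∑ j, tiltedMean (fun x : C j => hammingNorm x.1) z + a ≤ r)
    (hb : z = 1 ∨ b ≤ ∑ j, tiltedMean (fun x : C j => hammingNorm x.1) z - a) :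
    Real.logb (Fintype.card K) ((prodCode C).ncard /
      {c ∈ prodCode C | (hammingNorm c : ℝ) ≤ r}.ncard) ≤
      ∑ j, ((m j : ℝ) - parityLog (Fintype.card K) (m j) z) +
        b * Real.logb (Fintype.card K) z + 1 := by
  classical
  have hq : 2 ≤ Fintype.card K := Fintype.one_lt_card
  have hq2 : (2 : ℝ) ≤ Fintype.card K := by exact_mod_cast hq
  have hq' : (1 : ℝ) < Fintype.card K := by linarith
  have hw : ∀ j (x : C j), hammingNorm x.1 ≤ n := fun j x =>
    (hammingNorm_le_card_fintype (x := x.1)).trans (by simpa using hmn j)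
  have hM0 : 0 ≤ ∑ j, tiltedMean (fun x : C j => hammingNorm x.1) z :=
    Finset.sum_nonneg fun j _ => (tiltedMean_mem_Icc _ (hw j) hz.1).1
  have hr0 : 0 ≤ r := by linarith
  have hcheb := half_prod_weightEnum_le (fun j (x : C j) => hammingNorm x.1) hw hz.1 ha
    (by simpa using hcard)
  set M := ∑ j, tiltedMean (fun x : C j => hammingNorm x.1) z
  set W := ∏ j, weightEnum (fun x : C j => hammingNorm x.1) z with hWdef
  have hW : 0 < W := Finset.prod_pos fun j _ => weightEnum_pos _ hz.1
  set D := {c ∈ prodCode C | (hammingNorm c : ℝ) ≤ r}.ncard with hD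
  have hD1 : 1 ≤ D := one_le_ncard_prodCode_ball C hr0
  have hDpos : (0 : ℝ) < D := by exact_mod_cast hD1
  have hcount : W / 2 ≤ D * z ^ b := by
    calc W / 2 ≤ _ := hcheb
      _ ≤ ∑ y : ∀ j, C j with |((∑ j, hammingNorm (y j).1 : ℕ) : ℝ) - M| ≤ a, z ^ b := by
          refine Finset.sum_le_sum fun y hy => ?_
          have hy' := abs_le.1 (Finset.mem_filter.1 hy).2
          rcases hb with rfl | hb
          · simp
          · rw [← Real.rpow_natCast]
            exact Real.rpow_le_rpow_of_exponent_ge hz.1 hz.2 (by linarith [hy'.1])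
      _ = ((Finset.univ.filter fun y : ∀ j, C j =>
            |((∑ j, hammingNorm (y j).1 : ℕ) : ℝ) - M| ≤ a).card : ℝ) * z ^ b := by
          rw [Finset.sum_const, nsmul_eq_mul]
      _ ≤ D * z ^ b := by
          refine mul_le_mul_of_nonneg_right ?_ (Real.rpow_nonneg hz.1.le _)
          rw [hD, ncard_prodCode_sep C fun k => (k : ℝ) ≤ r]
          norm_cast
          refine Finset.card_le_card fun y hy => ?_
          have hy' := abs_le.1 (Finset.mem_filter.1 hy).2
          exact Finset.mem_filter.2 ⟨Finset.mem_univ _, by linarith [hy'.2]⟩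
  have hlog := Real.logb_le_logb_of_le hq' (by positivity) hcount
  rw [Real.logb_div hW.ne' two_ne_zero,
    Real.logb_mul hDpos.ne' (Real.rpow_pos_of_pos hz.1 _).ne',
    Real.logb_rpow_eq_mul_logb_of_pos hz.1] at hlog
  have hlog2 : Real.logb (Fintype.card K) 2 ≤ 1 := by
    rw [← Real.logb_self_eq_one hq']
    exact Real.logb_le_logb_of_le hq' two_pos hq2
  have hlogW : ∑ j, (parityLog (Fintype.card K) (m j) z - 1) ≤ Real.logb (Fintype.card K) W := by
    rw [hWdef, Real.logb_prod _ _ fun j _ => (weightEnum_pos _ hz.1).ne']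
    refine Finset.sum_le_sum fun j _ => ?_
    linarith [parityLog_le_logb_weightEnum (hm j) (C j) (hC j) hz]
  have h2 : 1 ≤ (prodCode C).ncard := hD1.trans (Set.ncard_le_ncard fun c hc => hc.1)
  have h3 : ((prodCode C).ncard : ℝ) ≠ 0 := by positivity
  rw [Real.logb_div h3 hDpos.ne', logb_ncard_prodCode C hm hC]
  have h4 : ∑ j, ((m j : ℝ) - parityLog (Fintype.card K) (m j) z) =
      ∑ j, ((m j : ℝ) - 1) - ∑ j, (parityLog (Fintype.card K) (m j) z - 1) := by
    rw [← Finset.sum_sub_distrib]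
    exact Finset.sum_congr rfl fun j _ => by ring
  linarith

/-- The tilting parameter can be chosen bounded away from zero. -/
theorem exists_tilt_logb_ncard_div_le (hm : ∀ j, 1 ≤ m j)
    (hC : ∀ j, Module.finrank K (C j) = m j - 1) {n : ℕ} (hmn : ∀ j, m j ≤ n)
    {N : ℕ} (hN : N = ∑ j, m j) (hN0 : 0 < N) {ω ω' ε δ : ℝ} (hε : 0 < ε) (hεω : 4 * ε ≤ ω)
    (hω' : ω - ε ≤ ω') (hNε : 2 * (n : ℝ) ^ 2 ≤ ε ^ 2 * N) (hδ : δ ∈ Ioc (0 : ℝ) 1)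
    (hδω : (Fintype.card K : ℝ) ^ n * n * δ ≤ ω / 2) :
    ∃ z ∈ Icc δ 1, Real.logb (Fintype.card K) ((prodCode C).ncard /
      {c ∈ prodCode C | (hammingNorm c : ℝ) ≤ ω' * N}.ncard) ≤
      ∑ j, ((m j : ℝ) - parityLog (Fintype.card K) (m j) z) +
        (ω - 3 * ε) * N * Real.logb (Fintype.card K) z + 1 := by
  have : ∀ j, Fintype (C j) := fun j => Fintype.ofFinite _
  have hq1 : (1 : ℝ) ≤ Fintype.card K := by exact_mod_cast Fintype.card_pos
  have hNpos : (0 : ℝ) < N := by exact_mod_cast hN0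
  have hℓN : (ℓ : ℝ) ≤ N := by
    have : ∑ _j : Fin ℓ, 1 ≤ ∑ j, m j := Finset.sum_le_sum fun j _ => hm j
    rw [← hN] at this
    exact_mod_cast (by simpa using this : ℓ ≤ N)
  have hw : ∀ j (x : C j), hammingNorm x.1 ≤ n := fun j x =>
    (hammingNorm_le_card_fintype (x := x.1)).trans (by simpa using hmn j)
  set M : ℝ → ℝ := fun z => ∑ j, tiltedMean (fun x : C j => hammingNorm x.1) z with hM
  have hcard : (ℓ : ℝ) * (n : ℝ) ^ 2 ≤ (ε * N) ^ 2 / 2 := by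
    have h1 := mul_le_mul_of_nonneg_right hℓN (sq_nonneg (n : ℝ))
    have h2 := mul_le_mul_of_nonneg_right hNε hNpos.le
    nlinarith
  have ha : 0 < ε * N := by positivity
  have hω'N := mul_le_mul_of_nonneg_right hω' hNpos.le
  rcases le_or_gt (M 1) ((ω - 2 * ε) * N) with h1 | h1
  · exact ⟨1, ⟨hδ.2, le_rfl⟩, logb_ncard_div_le_of_tilt C hm hC hmn ⟨one_pos, le_rfl⟩ ha hcard
      (by linarith) (Or.inl rfl)⟩
  · have hMδ : M δ ≤ (ω - 2 * ε) * N := by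
      calc M δ ≤ ∑ _j : Fin ℓ, ω / 2 := by
            refine Finset.sum_le_sum fun j _ => ?_
            refine (tiltedMean_le_mul (fun x : C j => hammingNorm x.1) (hw j)
              ⟨0, by simp⟩ hδ.1 hδ.2).trans (le_trans ?_ hδω)
            have : (Fintype.card (C j) : ℝ) ≤ (Fintype.card K : ℝ) ^ n := by
              rw [Module.card_eq_pow_finrank (K := K), hC]
              push_cast
              exact pow_le_pow_right₀ hq1 (by have := hmn j; omega)
            have h0 := hδ.1.le
            gcongr
        _ = ℓ * (ω / 2) := by simp
        _ ≤ N * (ω / 2) := mul_le_mul_of_nonneg_right hℓN (by linarith)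
        _ ≤ (ω - 2 * ε) * N := by nlinarith
    have hcont : ContinuousOn M (Icc δ 1) := by
      refine continuousOn_finsetSum _ fun j _ => ?_
      exact (continuousOn_tiltedMean _).mono fun x hx => hδ.1.trans_le hx.1
    obtain ⟨z, hz, hMz⟩ := intermediate_value_Icc hδ.2 hcont ⟨hMδ, h1.le⟩
    refine ⟨z, hz, logb_ncard_div_le_of_tilt C hm hC hmn ⟨hδ.1.trans_le hz.1, hz.2⟩ ha hcard
      ?_ (Or.inr ?_)⟩
    · change M z + _ ≤ _
      linarith
    · change _ ≤ M z - _
      linarith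

end ProductCode

theorem sum_parity_le_Rbar0_add {q n : ℕ} (hq : 2 ≤ q) (hn : 1 ≤ n) {ω μ : ℝ} (hω : 0 ≤ ω)
    (hμ : 1 ≤ μ) {ℓ : ℕ} {m : Fin ℓ → ℕ} (hm : ∀ j, 1 ≤ m j) (hmn : ∀ j, m j ≤ n)
    {N : ℕ} (hN : N = ∑ j, m j) (hN0 : 0 < N) {t : ℝ} (ht : t ∈ Icc (0 : ℝ) 1)
    (hℓ : 1 / μ - t * (1 - 1 / μ) ≤ (ℓ : ℝ) / N) {z : ℝ} (hz : z ∈ Ioc (0 : ℝ) 1) :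
    ω * Real.logb q z + (∑ j, ((m j : ℝ) - parityLog q (m j) z)) / N ≤ Rbar0 q n ω μ + t := by
  have hNpos : (0 : ℝ) < N := by exact_mod_cast hN0
  set π : ℕ → ℝ := fun s => ∑ j with m j = s, (m j : ℝ) / N with hπ
  have key : ∀ g : ℕ → ℝ, ∑ s ∈ Finset.Icc 1 n, π s * g s = (∑ j, (m j : ℝ) * g (m j)) / N := by
    intro g
    rw [Finset.sum_div, ← Finset.sum_fiberwise_of_maps_to (t := Finset.Icc 1 n) (g := m)
      fun j _ => Finset.mem_Icc.2 ⟨hm j, hmn j⟩]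
    refine Finset.sum_congr rfl fun s _ => ?_
    rw [hπ, Finset.sum_mul]
    refine Finset.sum_congr rfl fun j hj => ?_
    rw [(Finset.mem_filter.1 hj).2]
    ring
  have hπ0 : ∀ s ∈ Finset.Icc 1 n, 0 ≤ π s := fun s _ =>
    Finset.sum_nonneg fun j _ => by positivity
  have hπ1 : ∑ s ∈ Finset.Icc 1 n, π s = 1 := by
    have := key fun _ => 1
    simp only [mul_one] at this
    rw [this, ← Nat.cast_sum, ← hN, div_self hNpos.ne']
  have hm0 : ∀ j, (m j : ℝ) ≠ 0 := fun j => by have := hm j; positivity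
  have hπμ : ∑ s ∈ Finset.Icc 1 n, π s / (s : ℝ) = ℓ / N := by
    have := key fun s => (s : ℝ)⁻¹
    simp only [← div_eq_mul_inv] at this
    rw [this, Finset.sum_congr rfl fun j _ => div_self (hm0 j)]
    simp
  have h := le_Rbar0_add hq hn hω hμ hπ0 hπ1 ht (hℓ.trans_eq hπμ.symm) hz
  rw [key fun s => 1 - parityLog q s z / s] at h
  convert h using 4 with j
  have := hm0 j
  field_simp

theorem exists_parityLog_le {q : ℕ} (hq : 2 ≤ q) (n : ℕ) {η : ℝ} (hη : 0 < η) :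
    ∃ z ∈ Ioc (0 : ℝ) 1, ∀ s ∈ Finset.Icc 1 n, parityLog q s z ≤ 1 + η := by
  have hq' : (1 : ℝ) < q := by exact_mod_cast hq
  have hev : ∀ s ∈ Finset.Icc 1 n, ∀ᶠ z in nhdsWithin (0 : ℝ) (Ioi 0), parityLog q s z ≤ 1 + η := by
    intro s _
    have hval : parityLog q s 0 = 1 := by
      simp [parityLog, Real.logb_self_eq_one hq']
    have hcont : ContinuousAt (parityLog q s) 0 := by
      have hc : ContinuousAt (fun z : ℝ => (1 + ((q : ℝ) - 1) * z) ^ s +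
          ((q : ℝ) - 1) * (1 - z) ^ s) 0 := by fun_prop
      have h0 : (1 + ((q : ℝ) - 1) * 0) ^ s + ((q : ℝ) - 1) * (1 - 0) ^ s ≠ 0 := by
        simp; positivity
      exact (hc.log h0).div_const _
    have := hcont.eventually (eventually_le_nhds (b := 1 + η) (by rw [hval]; linarith))
    exact this.filter_mono nhdsWithin_le_nhds
  have hall := (Finset.eventually_all _).2 hev
  have hIoc : ∀ᶠ z in nhdsWithin (0 : ℝ) (Ioi 0), z ∈ Ioc (0 : ℝ) 1 :=
    Ioc_mem_nhdsGT one_pos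
  obtain ⟨z, hz, hz'⟩ := (hIoc.and hall).exists
  exact ⟨z, hz, hz'⟩

/-- If the average block length is asymptotically at most `μ`, then the number of blocks per
coordinate is asymptotically at least `1 / μ`. -/
theorem eventually_inv_sub_le_div {N ℓ : ℕ → ℕ} {μ B : ℝ} (hμ : 1 ≤ μ)
    (hB : ∀ i, (N i : ℝ) / ℓ i ≤ B)
    (havg : limsup (fun i => (N i : ℝ) / (ℓ i : ℝ)) atTop ≤ μ)
    (hpos : ∀ᶠ i in atTop, 0 < N i ∧ 0 < ℓ i) {κ : ℝ} (hκ : 0 < κ) :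
    ∀ᶠ i in atTop, 1 / μ - κ ≤ (ℓ i : ℝ) / N i := by
  have hlt := eventually_lt_of_limsup_lt (havg.trans_lt (lt_add_of_pos_right μ hκ))
    (isBoundedUnder_of ⟨B, hB⟩)
  filter_upwards [hlt, hpos] with i hi hp
  have hN : (0 : ℝ) < N i := by exact_mod_cast hp.1
  have hℓ : (0 : ℝ) < ℓ i := by exact_mod_cast hp.2
  have h1 : 1 / (μ + κ) ≤ (ℓ i : ℝ) / N i := by
    rw [div_lt_iff₀ hℓ] at hi
    rw [div_le_div_iff₀ (by linarith) hN]
    linarith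
  have h2 : 1 / μ - κ ≤ 1 / (μ + κ) := by
    rw [sub_le_iff_le_add, div_le_iff₀ (by linarith), add_mul, div_mul_eq_mul_div,
      ← sub_nonneg]
    have h3 : 1 * μ / (μ + κ) = 1 - κ / (μ + κ) := by field_simp; ring
    have h4 : κ / (μ + κ) ≤ κ := div_le_self hκ.le (by linarith)
    nlinarith
  linarith

/-- Lemma (average constituent length at most `μ`): if `(A_i)` is a sequence of linear
codes over `F` of strictly increasing lengths `N_i`, each a Cartesian product of `ℓ_i`
linear `[n_{i,j}, n_{i,j}-1]` codes of lengths `n_{i,j} ≤ n` with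
`limsup_i N_i/ℓ_i ≤ μ`, then for any nonnegative reals `ω_i` with `liminf_i ω_i = ω`,
`limsup_i (1/N_i)·log_q(|A_i| / |A_i(ω_i)|) ≤ R̄_0(ω,n,μ)`. -/
theorem lemma_mu
    (K : Type) [Field K] [Fintype K] [DecidableEq K]
    (q : ℕ) (hq : Fintype.card K = q)
    (n : ℕ) (hn : 1 ≤ n)
    (μ : ℝ) (hμ : μ ∈ Set.Icc (1:ℝ) (n:ℝ))
    -- the constituent codes: `ℓ i` of them in `A i`, of lengths `m i j`
    (ℓ : ℕ → ℕ) (m : ∀ i : ℕ, Fin (ℓ i) → ℕ)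
    (hm1 : ∀ i j, 1 ≤ m i j) (hmn : ∀ i j, m i j ≤ n)
    (Cc : ∀ (i : ℕ) (j : Fin (ℓ i)), Submodule K (Fin (m i j) → K))
    (hdim : ∀ i j, Module.finrank K (Cc i j) = m i j - 1)
    -- the lengths, strictly increasing
    (N : ℕ → ℕ) (hN : ∀ i, N i = ∑ j, m i j)
    (hmono : StrictMono N)
    -- average constituent length is asymptotically at most `μ`
    (havg : limsup (fun i => (N i : ℝ) / (ℓ i : ℝ)) atTop ≤ μ)
    -- `A i` is the Cartesian product of the constituent codes
    (A : ∀ i : ℕ, Set ((Σ j : Fin (ℓ i), Fin (m i j)) → K))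
    (hA : ∀ i, A i = {x | ∀ j : Fin (ℓ i), (fun t => x ⟨j, t⟩) ∈ Cc i j})
    -- the weight fractions
    (ωs : ℕ → ℝ) (hωs : ∀ i, 0 ≤ ωs i)
    (ω : ℝ) (hω : liminf ωs atTop = ω) :
    limsup (fun i =>
        Real.logb q (((A i).ncard : ℝ) /
          (({c ∈ A i | (hammingNorm c : ℝ) ≤ ωs i * (N i : ℝ)}).ncard : ℝ)) / (N i : ℝ))
      atTop ≤ Rbar0 q n ω μ := by
  subst hq
  set q := Fintype.card K
  have hq2 : 2 ≤ q := Fintype.one_lt_card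
  have hq1 : (1 : ℝ) < q := by exact_mod_cast hq2
  have hω0 : 0 ≤ ω := by
    rw [← hω, liminf_eq]
    exact Real.sSup_nonneg' ⟨0, Eventually.of_forall hωs, le_rfl⟩
  obtain rfl : A = fun i => prodCode (Cc i) := funext hA
  have hNtop : Tendsto (fun i => (N i : ℝ)) atTop atTop :=
    tendsto_natCast_atTop_atTop.comp hmono.tendsto_atTop
  have hNpos : ∀ᶠ i in atTop, 0 < N i := hmono.tendsto_atTop.eventually_gt_atTop 0
  have hpos : ∀ᶠ i in atTop, 0 < N i ∧ 0 < ℓ i := by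
    filter_upwards [hNpos] with i hi
    refine ⟨hi, Nat.pos_of_ne_zero fun h0 => ?_⟩
    have : IsEmpty (Fin (ℓ i)) := by rw [h0]; infer_instance
    rw [hN, Finset.univ_eq_empty, Finset.sum_empty] at hi
    exact lt_irrefl _ hi
  have hNle : ∀ i, (N i : ℝ) / ℓ i ≤ n := by
    intro i
    refine div_le_of_le_mul₀ (by positivity) (by positivity) ?_
    rw [hN]
    have : ∑ j, m i j ≤ ∑ _j : Fin (ℓ i), n := Finset.sum_le_sum fun j _ => hmn i j
    simp only [Finset.sum_const, Finset.card_univ, Fintype.card_fin, smul_eq_mul] at this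
    rw [mul_comm]
    exact_mod_cast this
  have hratio := fun {κ : ℝ} (hκ : 0 < κ) =>
    eventually_inv_sub_le_div hμ.1 hNle havg hpos hκ
  have hsum : ∀ i, ∑ j, ((m i j : ℝ) - 1) = N i - ℓ i := by
    intro i
    rw [Finset.sum_sub_distrib, hN]
    simp
  have htriv : ∀ i, Real.logb q (((prodCode (Cc i)).ncard : ℝ) /
      (({c ∈ prodCode (Cc i) | (hammingNorm c : ℝ) ≤ ωs i * (N i : ℝ)}).ncard : ℝ)) ≤
      ∑ j, ((m i j : ℝ) - 1) := fun i =>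
    logb_ncard_div_le (Cc i) (hm1 i) (hdim i) (mul_nonneg (hωs i) (Nat.cast_nonneg _))
  set E : ℕ → ℝ := fun i => Real.logb q (((prodCode (Cc i)).ncard : ℝ) /
      (({c ∈ prodCode (Cc i) | (hammingNorm c : ℝ) ≤ ωs i * (N i : ℝ)}).ncard : ℝ)) / (N i : ℝ)
  have hE0 : ∀ i, 0 ≤ E i := by
    intro i
    refine div_nonneg (Real.logb_nonneg hq1 ?_) (Nat.cast_nonneg _)
    have h1 := one_le_ncard_prodCode_ball (Cc i)
      (mul_nonneg (hωs i) (Nat.cast_nonneg (α := ℝ) (N i)))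
    rw [one_le_div (by exact_mod_cast h1)]
    exact_mod_cast Set.ncard_le_ncard (Set.sep_subset _ _)
  have htilt : ∀ η : ℝ, 0 < η → ∀ᶠ i in atTop, ∃ z ∈ Ioc (0 : ℝ) 1,
      E i ≤ ω * Real.logb q z + (∑ j, ((m i j : ℝ) - parityLog q (m i j) z)) / N i + η := by
    intro η hη
    rcases hω0.eq_or_lt with h0 | hωpos
    · obtain ⟨z, hz, hzη⟩ := exists_parityLog_le hq2 n hη
      filter_upwards [hNpos] with i hi
      have hNi : (0 : ℝ) < N i := by exact_mod_cast hi
      refine ⟨z, hz, ?_⟩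
      have h1 : ∑ j, ((m i j : ℝ) - 1) ≤ ∑ j, ((m i j : ℝ) - parityLog q (m i j) z) + N i * η := by
        rw [hN, Nat.cast_sum, Finset.sum_mul, ← Finset.sum_add_distrib]
        refine Finset.sum_le_sum fun j _ => ?_
        have h2 := hzη (m i j) (Finset.mem_Icc.2 ⟨hm1 i j, hmn i j⟩)
        have h3 : (1 : ℝ) ≤ m i j := by exact_mod_cast hm1 i j
        nlinarith
      have h4 := div_le_div_of_nonneg_right ((htriv i).trans h1) hNi.le
      rw [add_div, mul_div_cancel_left₀ _ hNi.ne'] at h4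
      rw [← h0, zero_mul, zero_add]
      exact h4
    · have hn0 : (0 : ℝ) < n := by exact_mod_cast hn
      set δ : ℝ := min 1 (ω / 2 / ((q : ℝ) ^ n * n)) with hδdef
      have hqn : 0 < (q : ℝ) ^ n * n := by positivity
      have hδ : δ ∈ Ioc (0 : ℝ) 1 := ⟨lt_min one_pos (by positivity), min_le_left _ _⟩
      have hδω : (q : ℝ) ^ n * n * δ ≤ ω / 2 := by
        have := min_le_right 1 (ω / 2 / ((q : ℝ) ^ n * n))
        rw [← hδdef, le_div_iff₀ hqn] at this
        linarith
      set L : ℝ := 1 - Real.logb q δ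
      have hL1 : 1 ≤ L := by
        have := Real.logb_nonpos hq1 hδ.1.le hδ.2
        linarith
      set ε : ℝ := min (ω / 4) (η / (6 * L)) with hεdef
      have hε : 0 < ε := lt_min (by linarith) (by positivity)
      have hεω : 4 * ε ≤ ω := by linarith [min_le_left (ω / 4) (η / (6 * L))]
      have hεL : 3 * ε * L ≤ η / 2 := by
        have := min_le_right (ω / 4) (η / (6 * L))
        rw [← hεdef, le_div_iff₀ (by linarith)] at this
        linarith
      have hωev : ∀ᶠ i in atTop, ω - ε < ωs i :=
        eventually_lt_of_lt_liminf (by rw [hω]; linarith) (isBoundedUnder_of ⟨0, hωs⟩)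
      filter_upwards [hNpos, hωev, hNtop.eventually_ge_atTop (2 * (n : ℝ) ^ 2 / ε ^ 2),
        hNtop.eventually_ge_atTop (2 / η)] with i hi hωi hN1 hN2
      have hNi : (0 : ℝ) < N i := by exact_mod_cast hi
      rw [div_le_iff₀ (by positivity)] at hN1 hN2
      obtain ⟨z, hz, hle⟩ := exists_tilt_logb_ncard_div_le (Cc i) (hm1 i) (hdim i) (hmn i) (hN i)
        hi hε hεω hωi.le (by linarith) hδ hδω
      refine ⟨z, ⟨hδ.1.trans_le hz.1, hz.2⟩, ?_⟩
      have hlogz : Real.logb q δ ≤ Real.logb q z := Real.logb_le_logb_of_le hq1 hδ.1 hz.1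
      have h1 : 3 * ε * -Real.logb q z ≤ η / 2 :=
        (mul_le_mul_of_nonneg_left (by linarith) (by linarith)).trans hεL
      have h2 := mul_le_mul_of_nonneg_left h1 hNi.le
      refine (div_le_div_of_nonneg_right hle hNi.le).trans ?_
      rw [div_le_iff₀ hNi, add_mul, add_mul, div_mul_cancel₀ _ hNi.ne']
      linarith
  refine le_of_forall_pos_le_add fun κ hκ => ?_
  refine limsup_le_of_le (isCoboundedUnder_le_of_le atTop hE0) ?_
  rcases hμ.1.eq_or_lt with h1 | hμ1
  · filter_upwards [hratio hκ, hNpos] with i hr hi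
    have hNi : (0 : ℝ) < N i := by exact_mod_cast hi
    have h2 := div_le_div_of_nonneg_right ((htriv i).trans_eq (hsum i)) hNi.le
    rw [sub_div, div_self hNi.ne'] at h2
    rw [← h1] at hr
    have h3 := Rbar0_nonneg (n := n) hq2 ω μ
    linarith
  · set t : ℝ := min 1 (κ / 2)
    have ht0 : 0 < t := lt_min one_pos (by linarith)
    have htκ : t ≤ κ / 2 := min_le_right _ _
    have hd : 0 < 1 - 1 / μ := by
      rw [sub_pos, div_lt_one (by linarith)]
      exact hμ1
    filter_upwards [hratio (mul_pos ht0 hd), hNpos, htilt (κ / 2) (by linarith)]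
      with i hr hi ⟨z, hz, hEz⟩
    have h2 := sum_parity_le_Rbar0_add hq2 hn hω0 hμ.1 (hm1 i) (hmn i) (hN i) hi
      ⟨ht0.le, min_le_left _ _⟩ hr hz
    linarith
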